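/- Let H = H(2^a, 2^b; 2^{a−1}, 2^e−1) with max{1, a−b} < e < min{a, b}. Then the automorphism group of H has order 2^{a+b+min{a−2, e}}. -/

import Mathlib

/-- Relators for the metacyclic presentation
`⟨α, β ∣ α^n = 1, β^m = α^t, β α β⁻¹ = α^r⟩` (generator `true ↦ α`, `false ↦ β`). -/
def metacyclicRels (n m t r : ℕ) : Set (FreeGroup Bool) :=
  {FreeGroup.of true ^ n,
   FreeGroup.of false ^ m * (FreeGroup.of true ^ t)⁻¹,
   FreeGroup.of false * FreeGroup.of true * (FreeGroup.of false)⁻¹ *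
     (FreeGroup.of true ^ r)⁻¹}

/-- The metacyclic group `H(n, m; t, r)`. -/
abbrev Metacyclic (n m t r : ℕ) := PresentedGroup (metacyclicRels n m t r)

section Relations

variable {G : Type*} [Group G] {x y : G} {r : ℕ}

theorem pow_mul_pow_of_conj (h : y * x * y⁻¹ = x ^ r) (n m : ℕ) :
    y ^ n * x ^ m = x ^ (m * r ^ n) * y ^ n := by
  induction n generalizing m with
  | zero => simp
  | succ n ih =>
    have h1 : y * x ^ m = x ^ (m * r) * y := by
      rw [mul_comm m r, pow_mul, ← h, conj_pow]; group
    rw [pow_succ, mul_assoc, h1, ← mul_assoc, ih, mul_assoc, pow_succ' r, mul_assoc]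

theorem mul_pow_of_conj (h : y * x * y⁻¹ = x ^ r) (k l n : ℕ) :
    (x ^ k * y ^ l) ^ n = x ^ (k * ∑ t ∈ Finset.range n, (r ^ l) ^ t) * y ^ (l * n) := by
  induction n with
  | zero => simp
  | succ n ih =>
    rw [pow_succ, ih, mul_assoc, ← mul_assoc (y ^ (l * n)), pow_mul_pow_of_conj h,
      Finset.sum_range_succ, mul_add, pow_add, ← pow_mul r, Nat.mul_succ, pow_add]
    simp only [mul_assoc]

end Relations

section Arithmetic

theorem sum_range_two_mul_pow (q n : ℕ) :
    ∑ t ∈ Finset.range (2 * n), q ^ t = (1 + q) * ∑ t ∈ Finset.range n, (q ^ 2) ^ t := by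
  induction n with
  | zero => simp
  | succ n ih =>
    rw [Nat.mul_succ, Finset.sum_range_succ, Finset.sum_range_succ, ih, Finset.sum_range_succ]
    ring

theorem two_pow_dvd_sum_range_pow {q : ℕ} (hq : Odd q) (n : ℕ) :
    2 ^ n ∣ ∑ t ∈ Finset.range (2 ^ n), q ^ t := by
  induction n generalizing q with
  | zero => simp
  | succ n ih =>
    rw [pow_succ' 2 n, sum_range_two_mul_pow]
    exact mul_dvd_mul (by obtain ⟨s, rfl⟩ := hq; exact ⟨s + 1, by ring⟩) (ih hq.pow)

theorem odd_two_pow_sub_one {e : ℕ} (he : 1 ≤ e) : Odd (2 ^ e - 1) :=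
  Nat.Even.sub_odd Nat.one_le_two_pow ((Nat.even_pow.2 ⟨even_two, by omega⟩)) odd_one

/-- The 2-adic valuation of `(2 ^ e - 1) ^ n - 1` is `e` plus that of `n`, for even `n`. -/
theorem two_pow_dvd_pow_sub_one_iff {e n : ℕ} (he : 1 < e) (hn : Even n) (s : ℕ) :
    (2 : ℤ) ^ s ∣ ((2 ^ e - 1 : ℕ) : ℤ) ^ n - 1 ↔ 2 ^ (s - e) ∣ n := by
  obtain ⟨d, rfl⟩ : ∃ d, e = d + 2 := ⟨e - 2, by omega⟩
  have hc : ((2 ^ (d + 2) - 1 : ℕ) : ℤ) = 2 ^ (d + 2) - 1 := by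
    rw [Nat.cast_sub Nat.one_le_two_pow]; simp
  have hodd : ¬ (2 : ℤ) ∣ 2 ^ (d + 2) - 1 := by
    rw [pow_succ]; omega
  have key := Int.two_pow_sub_pow (x := 2 ^ (d + 2) - 1) (y := 1)
    (by rw [pow_succ]; omega) hodd hn
  have h1 : emultiplicity (2 : ℤ) (2 ^ (d + 2) - 1 + 1) = ((d + 2 : ℕ) : ℕ∞) := by
    rw [sub_add_cancel]
    exact emultiplicity_pow_self_of_prime Int.prime_two _
  have h2 : emultiplicity (2 : ℤ) (2 ^ (d + 2) - 1 - 1) = 1 := by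
    have : (2 : ℤ) ^ (d + 2) - 1 - 1 = 2 * (2 ^ (d + 1) - 1) := by ring
    rw [this, emultiplicity_mul Int.prime_two,
      emultiplicity_eq_zero.2 (show ¬ (2 : ℤ) ∣ 2 ^ (d + 1) - 1 by rw [pow_succ]; omega), add_zero]
    simpa using emultiplicity_pow_self_of_prime Int.prime_two 1
  rw [h1, h2, one_pow] at key
  have key' : emultiplicity (2 : ℤ) ((2 ^ (d + 2) - 1) ^ n - 1)
      = ((d + 2 : ℕ) : ℕ∞) + emultiplicity (2 : ℤ) n := by
    have : emultiplicity (2 : ℤ) ((2 ^ (d + 2) - 1) ^ n - 1) + 1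
      = (((d + 2 : ℕ) : ℕ∞) + emultiplicity (2 : ℤ) n) + 1 := by rw [key]; ring
    exact (ENat.addLECancellable_of_ne_top ENat.one_ne_top).inj_left.1 this
  rw [hc, pow_dvd_iff_le_emultiplicity, key', ← Int.natCast_dvd_natCast]
  push_cast
  rw [pow_dvd_iff_le_emultiplicity]
  push_cast
  exact tsub_le_iff_left.symm

theorem two_pow_modEq_one {e n s : ℕ} (he : 1 < e) (hn : Even n) (h : 2 ^ (s - e) ∣ n) :
    (2 ^ e - 1) ^ n ≡ 1 [MOD 2 ^ s] := by
  refine ((Nat.modEq_iff_dvd (n := 2 ^ s)).2 ?_).symm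
  push_cast [-Nat.cast_sub, -Nat.cast_pred]
  have := (two_pow_dvd_pow_sub_one_iff he hn s).2 h
  exact_mod_cast this

theorem dvd_of_two_pow_modEq_one {e n s : ℕ} (he : 1 < e) (hn : Even n)
    (h : (2 ^ e - 1) ^ n ≡ 1 [MOD 2 ^ s]) : 2 ^ (s - e) ∣ n := by
  have := (Nat.modEq_iff_dvd (n := 2 ^ s)).1 h.symm
  refine (two_pow_dvd_pow_sub_one_iff he hn s).1 ?_
  exact_mod_cast this

theorem two_mul_modEq_cases {n m : ℕ} (h : n ≡ 1 [MOD m]) :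
    n ≡ 1 [MOD 2 * m] ∨ n ≡ 1 + m [MOD 2 * m] := by
  have h1 := (Nat.modEq_iff_dvd.1 h.symm)
  obtain ⟨c, hc⟩ := h1
  rcases Int.even_or_odd' c with ⟨d, rfl | rfl⟩
  · left
    refine (Nat.modEq_iff_dvd.2 ⟨d, ?_⟩).symm
    push_cast at *; linarith
  · right
    refine (Nat.modEq_iff_dvd.2 ⟨d, ?_⟩).symm
    push_cast at *; linarith

end Arithmetic

namespace Metacyclic

variable {n m t r : ℕ}

/-- The generator `α`. -/
def gen₁ (n m t r : ℕ) : Metacyclic n m t r := PresentedGroup.of true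

/-- The generator `β`. -/
def gen₂ (n m t r : ℕ) : Metacyclic n m t r := PresentedGroup.of false

theorem gen₁_pow : gen₁ n m t r ^ n = 1 :=
  PresentedGroup.one_of_mem (rels := metacyclicRels n m t r) (Or.inl rfl)

theorem gen₂_pow : gen₂ n m t r ^ m = gen₁ n m t r ^ t :=
  PresentedGroup.mk_eq_mk_of_mul_inv_mem (rels := metacyclicRels n m t r) (Or.inr (Or.inl rfl))

theorem gen₂_conj_gen₁ :
    gen₂ n m t r * gen₁ n m t r * (gen₂ n m t r)⁻¹ = gen₁ n m t r ^ r :=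
  PresentedGroup.mk_eq_mk_of_mul_inv_mem (rels := metacyclicRels n m t r) (Or.inr (Or.inr rfl))

theorem exists_lift {G : Type*} [Group G] {x y : G} (h₁ : x ^ n = 1) (h₂ : y ^ m = x ^ t)
    (h₃ : y * x * y⁻¹ = x ^ r) :
    ∃ f : Metacyclic n m t r →* G, f (gen₁ n m t r) = x ∧ f (gen₂ n m t r) = y := by
  have h : ∀ w ∈ metacyclicRels n m t r,
      FreeGroup.lift (fun i : Bool => if i then x else y) w = 1 := by
    rintro w (rfl | rfl | rfl) <;> simp [h₁, h₂, h₃]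
  exact ⟨PresentedGroup.toGroup h, by simp [gen₁], by simp [gen₂]⟩

theorem hom_ext {G : Type*} [Group G] {f g : Metacyclic n m t r →* G}
    (h₁ : f (gen₁ n m t r) = g (gen₁ n m t r)) (h₂ : f (gen₂ n m t r) = g (gen₂ n m t r)) :
    f = g :=
  PresentedGroup.ext fun i => by cases i <;> assumption

theorem closure_gens : Subgroup.closure {gen₁ n m t r, gen₂ n m t r} = ⊤ := by
  rw [← PresentedGroup.closure_range_of]
  congr 1
  ext w
  simp [gen₁, gen₂, or_comm]

theorem exists_eq_pow_mul_pow (hn : 0 < n) (hm : 0 < m) (w : Metacyclic n m t r) :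
    ∃ i < n, ∃ j < m, w = gen₁ n m t r ^ i * gen₂ n m t r ^ j := by
  have hβ : gen₂ n m t r ^ (m * n) = 1 := by
    rw [pow_mul, gen₂_pow, ← pow_mul, mul_comm, pow_mul, gen₁_pow, one_pow]
  have key : ∃ i j, w = gen₁ n m t r ^ i * gen₂ n m t r ^ j := by
    have hw : w ∈ Subgroup.closure {gen₁ n m t r, gen₂ n m t r} := by
      rw [closure_gens]; trivial
    induction hw using Subgroup.closure_induction with
    | mem w hw =>
      rcases hw with rfl | rfl
      · exact ⟨1, 0, by simp⟩
      · exact ⟨0, 1, by simp⟩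
    | one => exact ⟨0, 0, by simp⟩
    | mul u v _ _ hu hv =>
      obtain ⟨i, j, rfl⟩ := hu
      obtain ⟨k, l, rfl⟩ := hv
      refine ⟨i + k * r ^ j, j + l, ?_⟩
      rw [mul_assoc, ← mul_assoc (_ ^ j), pow_mul_pow_of_conj gen₂_conj_gen₁, pow_add, pow_add]
      simp only [mul_assoc]
    | inv u _ hu =>
      obtain ⟨i, j, rfl⟩ := hu
      refine ⟨((n - 1) * i) * r ^ ((m * n - 1) * j), (m * n - 1) * j, ?_⟩
      rw [← pow_mul_pow_of_conj gen₂_conj_gen₁, mul_inv_rev]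
      congr 1
      · rw [inv_eq_iff_mul_eq_one, ← pow_add,
          show j + (m * n - 1) * j = m * n * j by
            obtain ⟨c, hc⟩ : ∃ c, m * n = c + 1 := ⟨m * n - 1, by have := Nat.mul_pos hm hn; omega⟩
            rw [hc, Nat.add_sub_cancel]; ring, pow_mul, hβ, one_pow]
      · rw [inv_eq_iff_mul_eq_one, ← pow_add, show i + (n - 1) * i = n * i by
            obtain ⟨c, rfl⟩ : ∃ c, n = c + 1 := ⟨n - 1, by omega⟩
            rw [Nat.add_sub_cancel]; ring, pow_mul, gen₁_pow, one_pow]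
  obtain ⟨i, j, rfl⟩ := key
  refine ⟨(i + t * (j / m)) % n, Nat.mod_lt _ hn, j % m, Nat.mod_lt _ hm, ?_⟩
  have h : gen₁ n m t r ^ ((i + t * (j / m)) % n) = gen₁ n m t r ^ (i + t * (j / m)) := by
    conv_rhs => rw [← Nat.div_add_mod (i + t * (j / m)) n, pow_add, pow_mul, gen₁_pow, one_pow,
      one_mul]
  rw [h, pow_add, pow_mul, ← gen₂_pow, ← pow_mul, mul_assoc, ← pow_add, Nat.div_add_mod]

theorem finite (hn : 0 < n) (hm : 0 < m) : Finite (Metacyclic n m t r) := by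
  refine Finite.of_surjective
    (fun p : Fin n × Fin m => gen₁ n m t r ^ (p.1 : ℕ) * gen₂ n m t r ^ (p.2 : ℕ)) fun w => ?_
  obtain ⟨i, hi, j, hj, rfl⟩ := exists_eq_pow_mul_pow hn hm w
  exact ⟨(⟨i, hi⟩, ⟨j, hj⟩), rfl⟩

/-- The presentation is consistent: `α` has order exactly `n`. -/
theorem orderOf_gen₁ (hn : 0 < n) (hm : 0 < m) (hr : r ^ m ≡ 1 [MOD n])
    (ht : t * r ≡ t [MOD n]) : orderOf (gen₁ n m t r) = n := by
  have : NeZero n := ⟨hn.ne'⟩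
  have hcop : r.Coprime n := by
    refine Nat.Coprime.of_dvd_left (dvd_pow_self r hm.ne') ?_
    rw [Nat.Coprime, hr.gcd_eq]; simp
  let φ : Multiplicative ℤ →* MulAut (Multiplicative (ZMod n)) :=
    zpowersHom _ (AddEquiv.toMultiplicative
      (DistribMulAction.toAddEquiv (ZMod n) (ZMod.unitOfCoprime r hcop)))
  let A : Multiplicative (ZMod n) ⋊[φ] Multiplicative ℤ :=
    SemidirectProduct.inl (Multiplicative.ofAdd 1)
  let B : Multiplicative (ZMod n) ⋊[φ] Multiplicative ℤ :=
    SemidirectProduct.inr (Multiplicative.ofAdd 1)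
  have hA (j : ℕ) : A ^ j = SemidirectProduct.inl (Multiplicative.ofAdd (j : ZMod n)) := by
    rw [← map_pow, ← ofAdd_nsmul, nsmul_one]
  have hAn : A ^ n = 1 := by simp [hA]
  have hmod {i j : ℕ} (h : i ≡ j [MOD n]) : A ^ i = A ^ j := by
    rw [hA, hA, (ZMod.natCast_eq_natCast_iff _ _ _).2 h]
  have hconj : B * A * B⁻¹ = A ^ r := by
    rw [← map_inv, ← SemidirectProduct.inl_aut, hA]
    congr 1
    simp [φ, zpowersHom, Units.smul_def]
  let w := A ^ t * (B ^ m)⁻¹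
  have hwA : Commute w A := by
    refine ((Commute.refl A).pow_left t).mul_left (Commute.inv_left ?_)
    have := pow_mul_pow_of_conj hconj m 1
    rwa [one_mul, hmod hr, pow_one] at this
  have hwB : Commute w B := by
    refine Commute.mul_left ?_ (((Commute.refl B).pow_left m).inv_left)
    have := pow_mul_pow_of_conj hconj 1 t
    rw [pow_one, pow_one, hmod ht] at this
    exact this.symm
  have hw (g) : Commute w g := by
    rw [← SemidirectProduct.inl_left_mul_inr_right g]
    refine Commute.mul_right ?_ ?_
    · have : SemidirectProduct.inl g.left = A ^ (g.left.toAdd.val) := by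
        rw [hA, ZMod.natCast_zmod_val]; rfl
      rw [this]
      exact hwA.pow_right _
    · have : SemidirectProduct.inr g.right = B ^ (g.right.toAdd) := by
        rw [← map_zpow, ← ofAdd_zsmul, zsmul_eq_mul, mul_one]; rfl
      rw [this]
      exact hwB.zpow_right _
  have hnormal : (Subgroup.zpowers w).Normal := by
    refine ⟨fun u hu g => ?_⟩
    obtain ⟨k, rfl⟩ := hu
    have := ((hw g).zpow_left k).eq
    simp only [] at this ⊢
    rw [← this, mul_inv_cancel_right]
    exact ⟨k, rfl⟩
  let π := QuotientGroup.mk' (Subgroup.zpowers w)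
  obtain ⟨f, hf, -⟩ := exists_lift (n := n) (m := m) (t := t) (r := r) (x := π A) (y := π B)
    (by rw [← map_pow, hAn, map_one])
    (by
      rw [eq_comm, ← mul_inv_eq_one, ← π.map_pow, ← π.map_pow, ← π.map_inv, ← π.map_mul]
      exact (QuotientGroup.eq_one_iff w).2 (Subgroup.mem_zpowers w))
    (by rw [← map_mul, ← map_inv, ← map_mul, hconj, map_pow])
  refine Nat.dvd_antisymm (orderOf_dvd_of_pow_eq_one gen₁_pow) ?_
  have h1 : π (A ^ orderOf (gen₁ n m t r)) = 1 := by
    rw [map_pow, ← hf, ← map_pow, pow_orderOf_eq_one, map_one]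
  obtain ⟨k, hk⟩ := (QuotientGroup.eq_one_iff _).1 h1
  have hk0 : k = 0 := by
    have hwr : SemidirectProduct.rightHom w = Multiplicative.ofAdd (-(m : ℤ)) := by
      simp only [w, A, B, map_mul, map_pow, map_inv, SemidirectProduct.rightHom_inl,
        SemidirectProduct.rightHom_inr, one_pow, one_mul, ← ofAdd_nsmul, ← ofAdd_neg,
        nsmul_eq_mul, mul_one]
    have h := congrArg SemidirectProduct.rightHom hk
    simp only [A] at h
    rw [map_zpow, hwr, map_pow, SemidirectProduct.rightHom_inl, one_pow, ← ofAdd_zsmul,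
      ofAdd_eq_one] at h
    simpa [hm.ne'] using h
  subst hk0
  simp only [zpow_zero] at hk
  rw [hA, eq_comm, ← map_one SemidirectProduct.inl, SemidirectProduct.inl_inj] at hk
  exact (ZMod.natCast_eq_zero_iff _ _).1 hk

/-- The group `H(2^a, 2^b; 2^(a-1), 2^e - 1)`. -/
abbrev TypeII (a b e : ℕ) := Metacyclic (2 ^ a) (2 ^ b) (2 ^ (a - 1)) (2 ^ e - 1)

/-- The generator `α` of `TypeII a b e`. -/
abbrev α (a b e : ℕ) : TypeII a b e := gen₁ (2 ^ a) (2 ^ b) (2 ^ (a - 1)) (2 ^ e - 1)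

/-- The generator `β` of `TypeII a b e`. -/
abbrev β (a b e : ℕ) : TypeII a b e := gen₂ (2 ^ a) (2 ^ b) (2 ^ (a - 1)) (2 ^ e - 1)

/-- The central element `β ^ 2 ^ (b - 1)`. -/
abbrev ζ (a b e : ℕ) : TypeII a b e := β a b e ^ 2 ^ (b - 1)

variable {a b e : ℕ}

theorem half_mul_odd_modEq (ha : 0 < a) {u : ℕ} (hu : Odd u) (s : ℕ) :
    2 ^ (a - 1) * u * s ≡ 2 ^ (a - 1) * s [MOD 2 ^ a] := by
  obtain ⟨v, rfl⟩ := hu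
  have : 2 ^ (a - 1) * (2 * v + 1) * s = 2 ^ (a - 1) * s + 2 ^ a * (v * s) := by
    conv_rhs => rw [← Nat.sub_add_cancel (Nat.one_le_iff_ne_zero.2 ha.ne'), pow_succ]
    rw [Nat.add_sub_cancel]; ring
  rw [this]
  exact Nat.add_mul_mod_self_left ..

theorem two_pow_sub_one_eq (he : 1 < e) :
    ∃ q, Odd q ∧ 2 ^ e - 1 = 1 + 2 * q := by
  refine ⟨2 ^ (e - 1) - 1, odd_two_pow_sub_one (by omega), ?_⟩
  have : 2 ^ e = 2 * 2 ^ (e - 1) := by rw [← pow_succ', Nat.sub_add_cancel (by omega)]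
  have := Nat.one_le_two_pow (n := e - 1)
  omega

theorem two_pow_eq_two_mul (ha : 0 < a) : 2 ^ a = 2 * 2 ^ (a - 1) := by
  rw [← pow_succ', Nat.sub_add_cancel ha]

theorem orderOf_α (he1 : 1 < e) (habe : a - b < e) (hea : e < a) (heb : e < b) :
    orderOf (α a b e) = 2 ^ a := by
  refine orderOf_gen₁ (by positivity) (by positivity) ?_ ?_
  · exact two_pow_modEq_one he1 (Nat.even_pow.2 ⟨even_two, by omega⟩)
      (pow_dvd_pow 2 (by omega))
  · simpa using half_mul_odd_modEq (by omega) (odd_two_pow_sub_one (e := e) (by omega)) 1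

theorem α_pow_eq_iff (he1 : 1 < e) (habe : a - b < e) (hea : e < a) (heb : e < b) {i j : ℕ} :
    α a b e ^ i = α a b e ^ j ↔ i ≡ j [MOD 2 ^ a] := by
  rw [pow_eq_pow_iff_modEq, orderOf_α he1 habe hea heb]

theorem β_conj_α : β a b e * α a b e * (β a b e)⁻¹ = α a b e ^ (2 ^ e - 1) := gen₂_conj_gen₁

theorem ζ_sq (hb : 0 < b) : ζ a b e ^ 2 = α a b e ^ 2 ^ (a - 1) := by
  rw [← pow_mul, mul_comm, ← two_pow_eq_two_mul hb]
  exact gen₂_pow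

theorem commute_ζ_α (he1 : 1 < e) (habe : a - b < e) (hea : e < a) (heb : e < b) :
    Commute (ζ a b e) (α a b e) := by
  have h := pow_mul_pow_of_conj (β_conj_α (a := a) (b := b) (e := e)) (2 ^ (b - 1)) 1
  rw [one_mul, (α_pow_eq_iff he1 habe hea heb).2
    (two_pow_modEq_one (s := a) he1 (Nat.even_pow.2 ⟨even_two, by omega⟩)
      (pow_dvd_pow 2 (by omega)) : (2 ^ e - 1) ^ 2 ^ (b - 1) ≡ 1 [MOD 2 ^ a]), pow_one] at h
  exact h

theorem ζ_pow_two_pow (ha : 2 < a) (hb : 0 < b) : ζ a b e ^ 2 ^ (a - 1) = 1 := by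
  have h1 : 2 ^ (a - 1) = 2 * 2 ^ (a - 2) := by rw [← pow_succ']; congr 1; omega
  have h2 : 2 ^ (a - 1) * 2 ^ (a - 2) = 2 ^ a * 2 ^ (a - 3) := by
    rw [← pow_add, ← pow_add]; congr 1; omega
  calc ζ a b e ^ 2 ^ (a - 1) = ζ a b e ^ (2 * 2 ^ (a - 2)) := congrArg _ h1
    _ = α a b e ^ (2 ^ a * 2 ^ (a - 3)) := by rw [pow_mul, ζ_sq hb, ← pow_mul, h2]
    _ = 1 := by rw [pow_mul, show α a b e ^ 2 ^ a = 1 from gen₁_pow, one_pow]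

theorem pow_mul_ζ_pow_pow (he1 : 1 < e) (habe : a - b < e) (hea : e < a) (heb : e < b)
    (i ε n : ℕ) :
    (α a b e ^ i * ζ a b e ^ ε) ^ n = α a b e ^ (i * n) * ζ a b e ^ (ε * n) := by
  rw [((commute_ζ_α he1 habe hea heb).symm.pow_pow i ε).mul_pow, ← pow_mul, ← pow_mul]

theorem pow_mul_ζ_pow_two_pow (he1 : 1 < e) (habe : a - b < e) (hea : e < a) (heb : e < b)
    (i ε : ℕ) : (α a b e ^ i * ζ a b e ^ ε) ^ 2 ^ (a - 1) = α a b e ^ (2 ^ (a - 1) * i) := by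
  rw [pow_mul_ζ_pow_pow he1 habe hea heb, mul_comm ε, pow_mul (ζ a b e),
    ζ_pow_two_pow (by omega) (by omega), one_pow, mul_one, mul_comm i]

/-- When the images `α ↦ α^i ζ^ε`, `β ↦ α^k β^l` respect the conjugation relator. -/
theorem conj_eq_pow_iff (he1 : 1 < e) (habe : a - b < e) (hea : e < a) (heb : e < b)
    {i k l ε : ℕ} (hi : Odd i) (hl : Odd l) :
    (α a b e ^ k * β a b e ^ l) * (α a b e ^ i * ζ a b e ^ ε) * (α a b e ^ k * β a b e ^ l)⁻¹
      = (α a b e ^ i * ζ a b e ^ ε) ^ (2 ^ e - 1) ↔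
    (2 ^ e - 1) ^ (l - 1) ≡ 1 + 2 ^ (a - 1) * ε [MOD 2 ^ a] := by
  obtain ⟨q, hq, hr⟩ := two_pow_sub_one_eq he1
  have hζα := commute_ζ_α he1 habe hea heb
  have h1 : (α a b e ^ k * β a b e ^ l) * (α a b e ^ i * ζ a b e ^ ε)
      = α a b e ^ (i * (2 ^ e - 1) ^ l) * ζ a b e ^ ε * (α a b e ^ k * β a b e ^ l) := by
    have h2 := pow_mul_pow_of_conj (β_conj_α (a := a) (b := b) (e := e)) l i
    have h3 : β a b e ^ l * ζ a b e ^ ε = ζ a b e ^ ε * β a b e ^ l :=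
      (((Commute.refl (β a b e)).pow_left (2 ^ (b - 1))).pow_pow ε l).symm.eq
    have h4 := (hζα.pow_pow ε k).eq
    calc _ = α a b e ^ k * (β a b e ^ l * α a b e ^ i) * ζ a b e ^ ε := by
          simp only [mul_assoc]
      _ = (α a b e ^ k * α a b e ^ (i * (2 ^ e - 1) ^ l)) * (β a b e ^ l * ζ a b e ^ ε) := by
          rw [h2]; simp only [mul_assoc]
      _ = α a b e ^ (i * (2 ^ e - 1) ^ l) * (α a b e ^ k * ζ a b e ^ ε) * β a b e ^ l := by
          rw [h3, pow_mul_comm]; simp only [mul_assoc]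
      _ = _ := by rw [← h4]; simp only [mul_assoc]
  have h5 : (α a b e ^ i * ζ a b e ^ ε) ^ (2 ^ e - 1)
      = α a b e ^ (i * (2 ^ e - 1) + 2 ^ (a - 1) * q * ε) * ζ a b e ^ ε := by
    have h6 : ε * (2 ^ e - 1) = 2 * (q * ε) + ε := by rw [hr]; ring
    rw [pow_mul_ζ_pow_pow he1 habe hea heb, h6,
      pow_add (ζ a b e), pow_mul (ζ a b e), ζ_sq (by omega), ← pow_mul, ← mul_assoc, ← pow_add]
    simp only [mul_assoc]
  rw [h1, mul_inv_cancel_right, h5, mul_left_inj, α_pow_eq_iff he1 habe hea heb]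
  have hrodd : Odd (i * (2 ^ e - 1)) := hi.mul (odd_two_pow_sub_one (by omega))
  have h6 : i * (2 ^ e - 1) + 2 ^ (a - 1) * q * ε ≡
      i * (2 ^ e - 1) * (1 + 2 ^ (a - 1) * ε) [MOD 2 ^ a] := by
    have := ((half_mul_odd_modEq (a := a) (by omega) hq ε).trans
      (half_mul_odd_modEq (a := a) (by omega) hrodd ε).symm).add_left (i * (2 ^ e - 1))
    convert this using 1
    ring
  have h7 : i * (2 ^ e - 1) ^ l = i * (2 ^ e - 1) * (2 ^ e - 1) ^ (l - 1) := by
    conv_lhs => rw [← Nat.sub_add_cancel hl.pos, pow_succ']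
    rw [mul_assoc]
  rw [h7]
  constructor
  · intro h
    exact Nat.ModEq.cancel_left_of_coprime
      (Nat.Coprime.pow_left _ (Nat.coprime_two_left.2 hrodd)) (h.trans h6)
  · exact fun h => (h.mul_left _).trans h6.symm

theorem mul_pow_two_pow (he1 : 1 < e) (habe : a - b < e) (hea : e < a) (heb : e < b)
    {k l : ℕ} (hl : Odd l) :
    (α a b e ^ k * β a b e ^ l) ^ 2 ^ b = α a b e ^ 2 ^ (a - 1) := by
  have hr : Odd (2 ^ e - 1) := odd_two_pow_sub_one (by omega)
  have h1 : 2 ^ a ∣ ∑ t ∈ Finset.range (2 ^ b), ((2 ^ e - 1) ^ l) ^ t := by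
    rw [two_pow_eq_two_mul (show 0 < b by omega), sum_range_two_mul_pow]
    refine (pow_dvd_pow 2 (show a ≤ e + (b - 1) by omega)).trans ?_
    rw [pow_add]
    refine mul_dvd_mul ?_ (two_pow_dvd_sum_range_pow hr.pow.pow _)
    have := hl.nat_add_dvd_pow_add_pow 1 (2 ^ e - 1)
    rwa [one_pow, Nat.add_sub_cancel' Nat.one_le_two_pow] at this
  rw [mul_pow_of_conj β_conj_α, mul_comm l, pow_mul (β a b e),
    show β a b e ^ 2 ^ b = α a b e ^ 2 ^ (a - 1) from gen₂_pow, ← pow_mul, ← pow_add,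
    α_pow_eq_iff he1 habe hea heb]
  have h2 := (Nat.modEq_zero_iff_dvd.2 (h1.mul_left k)).add
    (half_mul_odd_modEq (a := a) (by omega) hl 1)
  simpa using h2

theorem exists_hom_two_pow (a e : ℕ) {b d : ℕ} (hd : d ≤ b) :
    ∃ χ : TypeII a b e →* Multiplicative (ZMod (2 ^ d)),
      ∀ i j : ℕ, χ (α a b e ^ i * β a b e ^ j) = Multiplicative.ofAdd (j : ZMod (2 ^ d)) := by
  obtain ⟨χ, h1, h2⟩ := exists_lift (n := 2 ^ a) (m := 2 ^ b) (t := 2 ^ (a - 1)) (r := 2 ^ e - 1)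
    (x := (1 : Multiplicative (ZMod (2 ^ d)))) (y := Multiplicative.ofAdd 1) (one_pow _)
    (by
      rw [one_pow, ← ofAdd_nsmul, nsmul_one, (ZMod.natCast_eq_zero_iff _ _).2 (pow_dvd_pow 2 hd)]
      rfl)
    (by simp)
  refine ⟨χ, fun i j => ?_⟩
  rw [map_mul, map_pow, map_pow]
  erw [h1, h2]
  rw [one_pow, one_mul, ← ofAdd_nsmul, nsmul_one]

theorem pow_mul_pow_inj (he1 : 1 < e) (habe : a - b < e) (hea : e < a) (heb : e < b)
    {i j k l : ℕ} (hi : i < 2 ^ a) (hj : j < 2 ^ b) (hk : k < 2 ^ a) (hl : l < 2 ^ b)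
    (h : α a b e ^ i * β a b e ^ j = α a b e ^ k * β a b e ^ l) : i = k ∧ j = l := by
  obtain ⟨χ, hχ⟩ := exists_hom_two_pow a e (le_refl b)
  have h1 := congrArg χ h
  rw [hχ, hχ, Multiplicative.ofAdd.apply_eq_iff_eq, ZMod.natCast_eq_natCast_iff] at h1
  obtain rfl := h1.eq_of_lt_of_lt hj hl
  rw [mul_left_inj, α_pow_eq_iff he1 habe hea heb] at h
  exact ⟨h.eq_of_lt_of_lt hi hk, rfl⟩

theorem mem_of_odd_pow_mem {G : Type*} [Group G] {K : Subgroup G} {w : G} {N u : ℕ}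
    (hw : w ^ 2 ^ N = 1) (hu : Odd u) (h : w ^ u ∈ K) : w ∈ K := by
  have hcop : u.Coprime (orderOf w) :=
    Nat.Coprime.of_dvd_right (orderOf_dvd_of_pow_eq_one hw)
      (Nat.Coprime.pow_right _ (Nat.coprime_two_right.2 hu))
  obtain ⟨s, hs⟩ := exists_pow_eq_self_of_coprime hcop
  rw [← hs]
  exact K.pow_mem h s

theorem eq_top_of_mem (he1 : 1 < e) (habe : a - b < e) (hea : e < a) (heb : e < b)
    {i k l ε : ℕ} (hi : Odd i) (hl : Odd l) {K : Subgroup (TypeII a b e)}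
    (hx : α a b e ^ i * ζ a b e ^ ε ∈ K) (hy : α a b e ^ k * β a b e ^ l ∈ K) : K = ⊤ := by
  have hα1 : α a b e ^ 2 ^ a = 1 := gen₁_pow
  have hβ1 : β a b e ^ 2 ^ (b + 1) = 1 := by
    rw [pow_succ, pow_mul, show β a b e ^ 2 ^ b = α a b e ^ 2 ^ (a - 1) from gen₂_pow, ← pow_mul,
      mul_comm, ← two_pow_eq_two_mul (by omega), hα1]
  have hα2 : α a b e ^ 2 ∈ K := by
    refine mem_of_odd_pow_mem (N := a) (u := i + 2 ^ (a - 2) * ε) ?_ ?_ ?_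
    · rw [← pow_mul, mul_comm, pow_mul, hα1, one_pow]
    · exact hi.add_even ((Nat.even_pow.2 ⟨even_two, by omega⟩).mul_right _)
    · have h := K.pow_mem hx 2
      rw [pow_mul_ζ_pow_pow he1 habe hea heb, mul_comm ε, pow_mul (ζ a b e), ζ_sq (by omega),
        ← pow_mul, ← pow_add] at h
      rw [← pow_mul]
      convert h using 2
      rw [two_pow_eq_two_mul (show 0 < a - 1 by omega), Nat.sub_sub]
      ring
  have hβ2 : β a b e ^ 2 ∈ K := by
    refine mem_of_odd_pow_mem (N := b) (u := l) ?_ hl ?_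
    · rw [← pow_mul, ← pow_succ', hβ1]
    · have h := K.pow_mem hy 2
      rw [mul_pow_of_conj β_conj_α] at h
      have hr : Odd ((2 ^ e - 1) ^ l) := (odd_two_pow_sub_one (by omega)).pow
      obtain ⟨s, hs⟩ := hr
      rw [Finset.sum_range_succ, Finset.sum_range_one, hs,
        show k * ((2 * s + 1) ^ 0 + (2 * s + 1) ^ 1) = 2 * (k * (s + 1)) by ring, pow_mul,
        mul_comm l, pow_mul (β a b e)] at h
      exact (K.mul_mem_cancel_left (K.pow_mem hα2 _)).1 h
  have hζ : ζ a b e ∈ K := by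
    rw [ζ, two_pow_eq_two_mul (show 0 < b - 1 by omega), pow_mul]
    exact K.pow_mem hβ2 _
  have hα : α a b e ∈ K :=
    mem_of_odd_pow_mem hα1 hi ((K.mul_mem_cancel_right (K.pow_mem hζ ε)).1 hx)
  have hβ : β a b e ∈ K :=
    mem_of_odd_pow_mem hβ1 hl ((K.mul_mem_cancel_left (K.pow_mem hα k)).1 hy)
  rw [eq_top_iff, ← closure_gens, Subgroup.closure_le]
  rintro w (rfl | rfl) <;> assumption

theorem exists_aut (he1 : 1 < e) (habe : a - b < e) (hea : e < a) (heb : e < b)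
    {i k l ε : ℕ} (hi : Odd i) (hl : Odd l)
    (h : (2 ^ e - 1) ^ (l - 1) ≡ 1 + 2 ^ (a - 1) * ε [MOD 2 ^ a]) :
    ∃ f : MulAut (TypeII a b e), f (α a b e) = α a b e ^ i * ζ a b e ^ ε ∧
      f (β a b e) = α a b e ^ k * β a b e ^ l := by
  have hx : (α a b e ^ i * ζ a b e ^ ε) ^ 2 ^ (a - 1) = α a b e ^ 2 ^ (a - 1) := by
    rw [pow_mul_ζ_pow_two_pow he1 habe hea heb, α_pow_eq_iff he1 habe hea heb]
    simpa using half_mul_odd_modEq (a := a) (by omega) hi 1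
  have hx' : (α a b e ^ i * ζ a b e ^ ε) ^ 2 ^ a = 1 := by
    have h2 : 2 ^ (a - 1) * 2 = 2 ^ a := by rw [mul_comm, ← two_pow_eq_two_mul (by omega)]
    calc _ = ((α a b e ^ i * ζ a b e ^ ε) ^ 2 ^ (a - 1)) ^ 2 := by
          rw [← pow_mul (α a b e ^ i * ζ a b e ^ ε), h2]
      _ = 1 := by rw [hx, ← pow_mul, h2, show α a b e ^ 2 ^ a = 1 from gen₁_pow]
  obtain ⟨f, hf₁, hf₂⟩ := exists_lift hx'
    ((mul_pow_two_pow he1 habe hea heb (k := k) hl).trans hx.symm)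
    ((conj_eq_pow_iff he1 habe hea heb hi hl).2 h)
  have hsurj : Function.Surjective f :=
    MonoidHom.range_eq_top.1 <| eq_top_of_mem he1 habe hea heb hi hl ⟨_, hf₁⟩ ⟨_, hf₂⟩
  have : Finite (TypeII a b e) := finite (by positivity) (by positivity)
  exact ⟨MulEquiv.ofBijective f ⟨Finite.injective_iff_surjective.2 hsurj, hsurj⟩, hf₁, hf₂⟩

theorem aut_apply (he1 : 1 < e) (habe : a - b < e) (hea : e < a) (heb : e < b)
    (f : MulAut (TypeII a b e)) :
    ∃ i < 2 ^ a, ∃ k < 2 ^ a, ∃ l < 2 ^ b, ∃ ε < 2, Odd i ∧ Odd l ∧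
      f (α a b e) = α a b e ^ i * ζ a b e ^ ε ∧ f (β a b e) = α a b e ^ k * β a b e ^ l ∧
      (2 ^ e - 1) ^ (l - 1) ≡ 1 + 2 ^ (a - 1) * ε [MOD 2 ^ a] := by
  obtain ⟨i, hi, j, hj, hx⟩ :=
    exists_eq_pow_mul_pow (by positivity) (by positivity) (f (α a b e))
  obtain ⟨k, hk, l, hl, hy⟩ :=
    exists_eq_pow_mul_pow (by positivity) (by positivity) (f (β a b e))
  have hconj : f (β a b e) * f (α a b e) * (f (β a b e))⁻¹ = f (α a b e) ^ (2 ^ e - 1) := by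
    rw [← map_mul, ← map_inv, ← map_mul, β_conj_α, map_pow]
  obtain ⟨q, hq, hr⟩ := two_pow_sub_one_eq he1
  have hj' : 2 ^ (b - 1) ∣ j := by
    obtain ⟨χ, hχ⟩ := exists_hom_two_pow a e (le_refl b)
    have h1 := congrArg χ hconj
    rw [map_mul, map_mul, map_inv, mul_inv_cancel_comm, map_pow, hx, hχ, ← ofAdd_nsmul,
      Multiplicative.ofAdd.apply_eq_iff_eq, nsmul_eq_mul, ← Nat.cast_mul,
      ZMod.natCast_eq_natCast_iff] at h1
    have h2 : (2 ^ e - 1) * j = j + 2 * (q * j) := by rw [hr]; ring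
    rw [h2] at h1
    have h3 := (Nat.modEq_iff_dvd' (by omega)).1 h1
    rw [Nat.add_sub_cancel_left, two_pow_eq_two_mul (show 0 < b by omega)] at h3
    exact (Nat.Coprime.pow_left _ (Nat.coprime_two_left.2 hq)).dvd_of_dvd_mul_left
      (Nat.dvd_of_mul_dvd_mul_left two_pos h3)
  obtain ⟨ε, rfl⟩ := hj'
  have hε : ε < 2 := by
    rw [two_pow_eq_two_mul (show 0 < b by omega), mul_comm] at hj
    exact lt_of_mul_lt_mul_right hj (by positivity)
  rw [pow_mul] at hx
  have hiodd : Odd i := by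
    rw [← Nat.not_even_iff_odd]
    rintro hi2
    obtain ⟨s, rfl⟩ := hi2.two_dvd
    have h1 : f (α a b e ^ 2 ^ (a - 1)) = 1 := by
      have h2 : 2 ^ (a - 1) * (2 * s) = 2 ^ a * s := by
        rw [two_pow_eq_two_mul (show 0 < a by omega)]; ring
      rw [map_pow, hx]
      refine (pow_mul_ζ_pow_two_pow he1 habe hea heb _ _).trans ?_
      rw [h2, pow_mul, show α a b e ^ 2 ^ a = 1 from gen₁_pow, one_pow]
    have h2 := orderOf_dvd_of_pow_eq_one ((map_eq_one_iff f f.injective).1 h1)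
    rw [orderOf_α he1 habe hea heb, Nat.pow_dvd_pow_iff_le_right'] at h2
    omega
  have hlodd : Odd l := by
    rw [← Nat.not_even_iff_odd]
    intro hl2
    obtain ⟨χ, hχ⟩ := exists_hom_two_pow a e (show 1 ≤ b by omega)
    have h1 : χ.comp f.toMonoidHom = 1 := by
      refine hom_ext ?_ ?_
      · change χ (f (α a b e)) = 1
        rw [hx, ← pow_mul]
        refine (hχ _ _).trans ?_
        rw [ofAdd_eq_one, ZMod.natCast_eq_zero_iff]
        exact (pow_dvd_pow 2 (by omega)).mul_right _
      · change χ (f (β a b e)) = 1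
        rw [hy]
        refine (hχ _ _).trans ?_
        rw [ofAdd_eq_one, ZMod.natCast_eq_zero_iff, pow_one]
        exact hl2.two_dvd
    have h2 : χ (f (f.symm (β a b e))) = 1 := DFunLike.congr_fun h1 _
    have h3 := hχ 0 1
    rw [pow_zero, one_mul, pow_one (β a b e), ← f.apply_symm_apply (β a b e), h2, eq_comm, ofAdd_eq_one,
      ZMod.natCast_eq_zero_iff] at h3
    norm_num at h3
  refine ⟨i, hi, k, hk, l, hl, ε, hε, hiodd, hlodd, hx, hy, ?_⟩
  rw [hx, hy] at hconj
  exact (conj_eq_pow_iff he1 habe hea heb hiodd hlodd).1 hconj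

/-- The exponent of `ζ` in the image of `α` under an automorphism with `β ↦ α^k β^l`. -/
def twist (a e l : ℕ) : ℕ := if (2 ^ e - 1) ^ (l - 1) ≡ 1 [MOD 2 ^ a] then 0 else 1

theorem twist_spec {a e l : ℕ} (ha : 0 < a)
    (h : (2 ^ e - 1) ^ (l - 1) ≡ 1 [MOD 2 ^ (a - 1)]) :
    (2 ^ e - 1) ^ (l - 1) ≡ 1 + 2 ^ (a - 1) * twist a e l [MOD 2 ^ a] := by
  have h1 := two_mul_modEq_cases h
  rw [← two_pow_eq_two_mul ha] at h1
  unfold twist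
  split_ifs with h2
  · simpa using h2
  · simpa [h2] using h1

theorem eq_twist {a e l ε : ℕ} (ha : 0 < a) (hε : ε < 2)
    (h : (2 ^ e - 1) ^ (l - 1) ≡ 1 + 2 ^ (a - 1) * ε [MOD 2 ^ a]) : ε = twist a e l := by
  unfold twist
  split_ifs with h2
  · have h3 := (Nat.modEq_iff_dvd' (by omega)).1 (h2.symm.trans h)
    rw [Nat.add_sub_cancel_left, two_pow_eq_two_mul ha, mul_comm] at h3
    have := Nat.dvd_of_mul_dvd_mul_left (by positivity) h3
    omega
  · by_contra h3
    obtain rfl : ε = 0 := by omega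
    exact h2 (by simpa using h)

/-- The images of the generators under the automorphisms, as parametrised by exponents. -/
def autImage (a b e c : ℕ) (p : Fin (2 ^ (a - 1)) × Fin (2 ^ a) × Fin (2 ^ (b - c))) :
    TypeII a b e × TypeII a b e :=
  (α a b e ^ (2 * (p.1 : ℕ) + 1) * ζ a b e ^ twist a e (2 ^ c * p.2.2 + 1),
    α a b e ^ (p.2.1 : ℕ) * β a b e ^ (2 ^ c * (p.2.2 : ℕ) + 1))

theorem two_pow_mul_add_one_lt {b c m : ℕ} (hc : 0 < c) (hcb : c ≤ b) (hm : m < 2 ^ (b - c)) :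
    2 ^ c * m + 1 < 2 ^ b := by
  have h1 : 2 ^ c * (m + 1) ≤ 2 ^ c * 2 ^ (b - c) := Nat.mul_le_mul_left _ hm
  rw [← pow_add, Nat.add_sub_cancel' hcb] at h1
  have := Nat.one_lt_two_pow hc.ne'
  linarith

theorem autImage_injective (he1 : 1 < e) (habe : a - b < e) (hea : e < a) (heb : e < b)
    {c : ℕ} (hc : 0 < c) (hcb : c ≤ b) : Function.Injective (autImage a b e c) := by
  rintro ⟨⟨i, hi⟩, ⟨k, hk⟩, ⟨m, hm⟩⟩ ⟨⟨i', hi'⟩, ⟨k', hk'⟩, ⟨m', hm'⟩⟩ h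
  simp only [autImage, Prod.mk.injEq] at h
  obtain ⟨rfl, h2⟩ := pow_mul_pow_inj he1 habe hea heb hk (two_pow_mul_add_one_lt hc hcb hm) hk'
    (two_pow_mul_add_one_lt hc hcb hm') h.2
  obtain rfl : m = m' := Nat.eq_of_mul_eq_mul_left (Nat.two_pow_pos c) (Nat.add_right_cancel h2)
  have h3 := h.1
  rw [mul_left_inj, α_pow_eq_iff he1 habe hea heb] at h3
  have h4 := two_pow_eq_two_mul (show 0 < a by omega)
  have h5 := h3.eq_of_lt_of_lt (by omega) (by omega)
  obtain rfl : i = i' := by omega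
  rfl

theorem range_autImage (he1 : 1 < e) (habe : a - b < e) (hea : e < a) (heb : e < b) :
    Set.range (autImage a b e (max 1 (a - 1 - e))) =
      Set.range fun f : MulAut (TypeII a b e) => (f (α a b e), f (β a b e)) := by
  set c := max 1 (a - 1 - e) with hc
  ext ⟨x, y⟩
  constructor
  · rintro ⟨⟨i, k, m⟩, h⟩
    simp only [autImage, Prod.mk.injEq] at h
    obtain ⟨rfl, rfl⟩ := h
    have heven : Even (2 ^ c * (m : ℕ)) := (Nat.even_pow.2 ⟨even_two, by omega⟩).mul_right _
    obtain ⟨f, hf₁, hf₂⟩ := exists_aut he1 habe hea heb (k := k) (odd_two_mul_add_one (i : ℕ))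
      heven.add_one (twist_spec (a := a) (e := e) (by omega)
        (by
          rw [Nat.add_sub_cancel]
          exact two_pow_modEq_one he1 heven ((pow_dvd_pow 2 (by omega)).mul_right _)))
    exact ⟨f, Prod.ext hf₁ hf₂⟩
  · rintro ⟨f, h⟩
    simp only [Prod.mk.injEq] at h
    obtain ⟨rfl, rfl⟩ := h
    obtain ⟨i, hi, k, hk, l, hl, ε, hε, hiodd, hlodd, hx, hy, h⟩ :=
      aut_apply he1 habe hea heb f
    obtain rfl := eq_twist (by omega) hε h
    have hle : Even (l - 1) := Nat.Odd.sub_odd hlodd odd_one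
    have h1 : (2 ^ e - 1) ^ (l - 1) ≡ 1 [MOD 2 ^ (a - 1)] := by
      refine (h.of_dvd (pow_dvd_pow 2 (Nat.sub_le a 1))).trans ?_
      exact Nat.add_mul_mod_self_left ..
    have hdvd : 2 ^ c ∣ l - 1 := by
      rcases max_choice 1 (a - 1 - e) with h2 | h2
      · rw [hc, h2, pow_one]; exact hle.two_dvd
      · rw [hc, h2]; exact dvd_of_two_pow_modEq_one he1 hle h1
    obtain ⟨m, hm⟩ := hdvd
    obtain ⟨s, rfl⟩ := hiodd
    have hl1 : l = 2 ^ c * m + 1 := by have := hlodd.pos; omega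
    subst hl1
    have hm' : m < 2 ^ (b - c) := by
      have h3 : 2 ^ c * m < 2 ^ c * 2 ^ (b - c) := by
        rw [← pow_add, Nat.add_sub_cancel' (by omega)]; omega
      exact lt_of_mul_lt_mul_left h3 (by positivity)
    have h4 := two_pow_eq_two_mul (show 0 < a by omega)
    exact ⟨(⟨s, by omega⟩, ⟨k, hk⟩, ⟨m, hm'⟩), Prod.ext hx.symm hy.symm⟩

end Metacyclic

/-- Theorem 3.2 (order part): for `H = H(2^a, 2^b; 2^(a-1), 2^e - 1)` with
`max{1, a-b} < e < min{a, b}`, the automorphism group of `H` has order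
`2^(a + b + min{a-2, e})`. -/
theorem typeII_aut_card (a b e : ℕ) (he1 : 1 < e) (habe : a - b < e) (hea : e < a)
    (heb : e < b) :
    Nat.card (MulAut (Metacyclic (2 ^ a) (2 ^ b) (2 ^ (a - 1)) (2 ^ e - 1)))
      = 2 ^ (a + b + min (a - 2) e) := by
  have hinj : Function.Injective fun f : MulAut (Metacyclic.TypeII a b e) =>
      (f (Metacyclic.α a b e), f (Metacyclic.β a b e)) := by
    intro f g h
    simp only [Prod.mk.injEq] at h
    exact MulEquiv.toMonoidHom_injective (Metacyclic.hom_ext h.1 h.2)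
  have hinj' := Metacyclic.autImage_injective he1 habe hea heb (c := max 1 (a - 1 - e))
    (by omega) (by omega)
  rw [Nat.card_congr (Equiv.ofInjective _ hinj), ← Metacyclic.range_autImage he1 habe hea heb,
    ← Nat.card_congr (Equiv.ofInjective _ hinj')]
  simp only [Nat.card_prod, Nat.card_fin, ← pow_add]
  congr 1
  omega
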